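/- Let (G, d) be a group with a two-sided invariant metric and let A ≤ G be a closed subgroup. Let G * ⟨t⟩ be the free product of G with an infinite cyclic group generated by t, equipped with the Graev metric d*: the maximal two-sided invariant metric satisfying d*(g, h) = d(g, h) for g, h ∈ G, d*(tᵐ, tⁿ) = |m − n| for m, n ∈ ℤ, and d*(g, tᵏ) = d(g, 1) + |k| for g ∈ G, k ∈ ℤ. Then the subgroup of G * ⟨t⟩ generated by G together with { t·a·t⁻¹ : a ∈ A } (which is abstractly the free product G * tAt⁻¹) is a closed subset of (G * ⟨t⟩, d*). -/

import Mathlib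

/-- A two-sided invariant metric on a group. -/
def IsTSIMetric {G : Type*} [Group G] (d : G → G → ℝ) : Prop :=
  (∀ x y : G, d x y = 0 ↔ x = y) ∧
  (∀ x y : G, d x y = d y x) ∧
  (∀ x y z : G, d x z ≤ d x y + d y z) ∧
  (∀ g x y : G, d (g * x) (g * y) = d x y) ∧
  (∀ g x y : G, d (x * g) (y * g) = d x y)

/-- A set is closed with respect to the metric `d`. -/
def IsDClosed {G : Type*} (d : G → G → ℝ) (S : Set G) : Prop :=
  ∀ x : G, (∀ ε : ℝ, 0 < ε → ∃ s ∈ S, d x s < ε) → x ∈ S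

/-- The Graev metric on the free product `G ∗ ⟨t⟩` of a tsi group with the integers: the maximal
two-sided invariant metric extending `d` on `G`, `|m − n|` on powers of `t`, and assigning
`d(g,1) + |k|` to mixed pairs. -/
def IsGraevMetricFreeProdZ {G : Type*} [Group G] (d : G → G → ℝ)
    (ds : Monoid.Coprod G (Multiplicative ℤ) → Monoid.Coprod G (Multiplicative ℤ) → ℝ) : Prop :=
  IsTSIMetric ds ∧
  (∀ g h : G, ds (Monoid.Coprod.inl g) (Monoid.Coprod.inl h) = d g h) ∧
  (∀ m n : ℤ, ds (Monoid.Coprod.inr (Multiplicative.ofAdd m))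
      (Monoid.Coprod.inr (Multiplicative.ofAdd n)) = |(m : ℝ) - (n : ℝ)|) ∧
  (∀ (g : G) (k : ℤ), ds (Monoid.Coprod.inl g) (Monoid.Coprod.inr (Multiplicative.ofAdd k))
      = d g 1 + |(k : ℝ)|) ∧
  (∀ δ : Monoid.Coprod G (Multiplicative ℤ) → Monoid.Coprod G (Multiplicative ℤ) → ℝ,
    IsTSIMetric δ →
    (∀ g h : G, δ (Monoid.Coprod.inl g) (Monoid.Coprod.inl h) = d g h) →
    (∀ m n : ℤ, δ (Monoid.Coprod.inr (Multiplicative.ofAdd m))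
      (Monoid.Coprod.inr (Multiplicative.ofAdd n)) = |(m : ℝ) - (n : ℝ)|) →
    (∀ (g : G) (k : ℤ), δ (Monoid.Coprod.inl g) (Monoid.Coprod.inr (Multiplicative.ofAdd k))
      = d g 1 + |(k : ℝ)|) →
    ∀ x y, δ x y ≤ ds x y)


namespace FreeProdClosed

open Monoid

section Words

variable {ι : Type*} {M : ι → Type*} [∀ i, Group (M i)]

/-- The element of the free product represented by a list of letters. -/
def letterProd (l : List (Σ i, M i)) : CoprodI M :=
  (l.map fun s => CoprodI.of s.2).prod

@[simp] lemma letterProd_nil : letterProd ([] : List (Σ i, M i)) = 1 := rfl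

@[simp] lemma letterProd_cons (s : Σ i, M i) (l : List (Σ i, M i)) :
    letterProd (s :: l) = CoprodI.of s.2 * letterProd l := by
  simp [letterProd]

@[simp] lemma letterProd_append (l₁ l₂ : List (Σ i, M i)) :
    letterProd (l₁ ++ l₂) = letterProd l₁ * letterProd l₂ := by
  simp [letterProd]

/-- The formal inverse of a list of letters. -/
def invRev (l : List (Σ i, M i)) : List (Σ i, M i) :=
  (l.map fun s => ⟨s.1, s.2⁻¹⟩).reverse

lemma letterProd_invRev (l : List (Σ i, M i)) : letterProd (invRev l) = (letterProd l)⁻¹ := by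
  induction l with
  | nil => simp [invRev]
  | cons s l ih =>
    have h : invRev (s :: l) = invRev l ++ [⟨s.1, s.2⁻¹⟩] := by simp [invRev]
    simp [h, ih]

/-- A list of letters is reduced if no letter is trivial and adjacent letters come from
different factors. -/
def IsReduced (l : List (Σ i, M i)) : Prop :=
  (∀ s ∈ l, s.2 ≠ 1) ∧ l.IsChain fun s t => s.1 ≠ t.1

lemma isReduced_or (l : List (Σ i, M i)) :
    IsReduced l ∨ (∃ l₁ i l₂, l = l₁ ++ ⟨i, 1⟩ :: l₂) ∨
      ∃ l₁ i a b l₂, l = l₁ ++ ⟨i, a⟩ :: ⟨i, b⟩ :: l₂ := by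
  by_cases h₁ : ∀ s ∈ l, s.2 ≠ 1
  · by_cases h₂ : l.IsChain fun s t => s.1 ≠ t.1
    · exact Or.inl ⟨h₁, h₂⟩
    · rw [List.isChain_iff_forall_rel_of_append_cons_cons] at h₂
      push Not at h₂
      obtain ⟨⟨i, a⟩, ⟨j, b⟩, l₁, l₂, h, rfl⟩ := h₂
      exact Or.inr (Or.inr ⟨l₁, i, a, b, l₂, h⟩)
  · push Not at h₁
    obtain ⟨⟨i, a⟩, hs, ha⟩ := h₁
    obtain rfl : a = 1 := ha
    obtain ⟨l₁, l₂, h⟩ := List.append_of_mem hs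
    exact Or.inr (Or.inl ⟨l₁, i, l₂, h⟩)

lemma IsReduced.eq_of_letterProd_eq {l l' : List (Σ i, M i)} (h : IsReduced l)
    (h' : IsReduced l') (e : letterProd l = letterProd l') : l = l' := by
  classical
  have := CoprodI.Word.equiv.symm.injective (a₁ := (⟨l, h.1, h.2⟩ : CoprodI.Word M))
    (a₂ := ⟨l', h'.1, h'.2⟩) e
  exact congrArg CoprodI.Word.toList this

/-- Some letter of `l` lies in the factor `i` and the product of `x` with the letters before it
is trivial. -/
def HasPartner (i : ι) : CoprodI M → List (Σ i, M i) → Prop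
  | _, [] => False
  | x, s :: l => (s.1 = i ∧ x = 1) ∨ HasPartner i (x * CoprodI.of s.2) l

lemma HasPartner.exists_eq_append {i : ι} {x : CoprodI M} {l : List (Σ i, M i)}
    (h : HasPartner i x l) :
    ∃ v c w, l = v ++ ⟨i, c⟩ :: w ∧ x * letterProd v = 1 := by
  induction l generalizing x with
  | nil => exact h.elim
  | cons s l ih =>
    rcases h with ⟨rfl, rfl⟩ | h
    · exact ⟨[], s.2, l, rfl, by simp⟩
    · obtain ⟨v, c, w, rfl, hv⟩ := ih h
      exact ⟨s :: v, c, w, rfl, by simpa [mul_assoc] using hv⟩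

lemma HasPartner.of_append {i : ι} {l₁ l₂ l₂' : List (Σ i, M i)}
    (H : ∀ x, HasPartner i x l₂ → HasPartner i x l₂') (x : CoprodI M)
    (h : HasPartner i x (l₁ ++ l₂)) : HasPartner i x (l₁ ++ l₂') := by
  induction l₁ generalizing x with
  | nil => exact H x h
  | cons s l ih => exact h.imp_right (ih _)

lemma exists_isReduced (l : List (Σ i, M i)) :
    ∃ l', IsReduced l' ∧ letterProd l' = letterProd l ∧
      (∀ i x, HasPartner i x l' → HasPartner i x l) ∧
      ∀ A : ∀ i, Subgroup (M i), (∀ s ∈ l, s.2 ∈ A s.1) → ∀ s ∈ l', s.2 ∈ A s.1 := by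
  induction hn : l.length using Nat.strong_induction_on generalizing l with
  | _ n ih =>
    rcases isReduced_or l with h | ⟨l₁, i, l₂, rfl⟩ | ⟨l₁, i, a, b, l₂, rfl⟩
    · exact ⟨l, h, rfl, fun _ _ => id, fun _ => id⟩
    · obtain ⟨l', hr, hp, hP, hA⟩ := ih _ (by simp at hn ⊢; omega) (l₁ ++ l₂) rfl
      refine ⟨l', hr, by simp [hp], fun j x hx =>
        HasPartner.of_append (fun y hy => ?_) x (hP j x hx), fun A h => hA A fun s hs => h s ?_⟩
      · exact Or.inr (by simpa using hy)
      · simp at hs ⊢; tauto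
    · obtain ⟨l', hr, hp, hP, hA⟩ := ih _ (by simp at hn ⊢; omega) (l₁ ++ ⟨i, a * b⟩ :: l₂) rfl
      refine ⟨l', hr, by simp [hp, mul_assoc], fun j x hx =>
        HasPartner.of_append (fun y hy => ?_) x (hP j x hx), fun A h => hA A fun s hs => ?_⟩
      · rcases hy with hy | hy
        · exact Or.inl hy
        · exact Or.inr (Or.inr (by simpa [mul_assoc] using hy))
      · simp only [List.mem_append, List.mem_cons] at hs h
        rcases hs with hs | rfl | hs
        · exact h s (Or.inl hs)
        · exact mul_mem (h ⟨i, a⟩ (by simp)) (h ⟨i, b⟩ (by simp))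
        · exact h s (by simp [hs])

lemma letterProd_mem_iSup {A : ∀ i, Subgroup (M i)} {l : List (Σ i, M i)}
    (h : ∀ s ∈ l, s.2 ∈ A s.1) :
    letterProd l ∈ ⨆ i, (A i).map (CoprodI.of : M i →* CoprodI M) := by
  refine Subgroup.list_prod_mem _ fun x hx => ?_
  obtain ⟨s, hs, rfl⟩ := List.mem_map.1 hx
  exact Subgroup.mem_iSup_of_mem s.1 (Subgroup.mem_map_of_mem _ (h s hs))

lemma exists_letterProd_of_mem_iSup {A : ∀ i, Subgroup (M i)} {x : CoprodI M}
    (hx : x ∈ ⨆ i, (A i).map (CoprodI.of : M i →* CoprodI M)) :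
    ∃ l : List (Σ i, M i), (∀ s ∈ l, s.2 ∈ A s.1) ∧ letterProd l = x := by
  refine Subgroup.iSup_induction
    (C := fun x => ∃ l : List (Σ i, M i), (∀ s ∈ l, s.2 ∈ A s.1) ∧ letterProd l = x)
    _ hx ?_ ⟨[], by simp, rfl⟩ ?_
  · rintro i _ ⟨a, ha, rfl⟩
    exact ⟨[⟨i, a⟩], by simpa using ha, by simp⟩
  · rintro _ _ ⟨l, hl, rfl⟩ ⟨l', hl', rfl⟩
    refine ⟨l ++ l', fun s hs => ?_, by simp⟩
    exact (List.mem_append.1 hs).elim (hl s) (hl' s)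

lemma IsReduced.forall_mem {A : ∀ i, Subgroup (M i)} {l : List (Σ i, M i)} (h : IsReduced l)
    (hl : letterProd l ∈ ⨆ i, (A i).map (CoprodI.of : M i →* CoprodI M)) :
    ∀ s ∈ l, s.2 ∈ A s.1 := by
  obtain ⟨l₁, h₁, e₁⟩ := exists_letterProd_of_mem_iSup hl
  obtain ⟨l₂, h₂, e₂, -, hA⟩ := exists_isReduced l₁
  rw [h.eq_of_letterProd_eq h₂ (e₁.symm.trans e₂.symm)]
  exact hA A h₁

/-- In a product lying in the subgroup generated by the `A i`, a letter can be deleted, unless it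
meets another letter of its factor after a trivial subword. -/
lemma mem_iSup_or_hasPartner {A : ∀ i, Subgroup (M i)} (p q : List (Σ i, M i)) {i : ι} (b : M i)
    (h : (letterProd p)⁻¹ * CoprodI.of b * letterProd q ∈
      ⨆ i, (A i).map (CoprodI.of : M i →* CoprodI M)) :
    (letterProd p)⁻¹ * letterProd q ∈ ⨆ i, (A i).map (CoprodI.of : M i →* CoprodI M) ∨
      HasPartner i 1 p ∨ HasPartner i 1 q := by
  obtain ⟨p', hp, ep, hP, -⟩ := exists_isReduced p
  obtain ⟨q', hq, eq, hQ, -⟩ := exists_isReduced q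
  by_contra! hcon
  obtain ⟨h₁, h₂, h₃⟩ := hcon
  have h₂ := mt (hP i 1) h₂
  have h₃ := mt (hQ i 1) h₃
  rw [← ep, ← eq] at h h₁
  rw [← letterProd_invRev] at h h₁
  have hred : IsReduced (invRev p' ++ ⟨i, b⟩ :: q') := by
    refine ⟨fun s hs => ?_, ?_⟩
    · simp only [List.mem_append, List.mem_cons] at hs
      rcases hs with hs | rfl | hs
      · simp only [invRev, List.mem_reverse, List.mem_map] at hs
        obtain ⟨t, ht, rfl⟩ := hs
        simpa using hp.1 t ht
      · intro hb
        obtain rfl : b = 1 := hb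
        exact h₁ (by simpa using h)
      · exact hq.1 s hs
    · rw [List.isChain_split]
      constructor
      · rw [← List.isChain_reverse]
        simp only [invRev, List.reverse_append, List.reverse_reverse, List.reverse_singleton,
          List.singleton_append]
        cases p' with
        | nil => simp
        | cons t p' =>
          simp only [HasPartner, and_true, not_or] at h₂
          rw [List.map_cons, List.isChain_cons_cons]
          refine ⟨h₂.1, ?_⟩
          change List.IsChain _ ((t :: p').map fun s => (⟨s.1, s.2⁻¹⟩ : Σ i, M i))
          rw [List.isChain_map]
          exact hp.2.imp fun _ _ h => h.symm
      · cases q' with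
        | nil => simp
        | cons t q' =>
          simp only [HasPartner, and_true, not_or] at h₃
          exact List.isChain_cons_cons.2 ⟨fun e => h₃.1 e.symm, hq.2⟩
  have hmem := hred.forall_mem (by simpa [mul_assoc] using h)
  refine h₁ ?_
  rw [← letterProd_append]
  exact letterProd_mem_iSup fun s hs => hmem s (by simp at hs ⊢; tauto)

end Words

section Pairs

variable {ι : Type*} {M : ι → Type*}

/-- The list of first components of a list of pairs of letters. -/
def fsts (L : List (Σ i, M i × M i)) : List (Σ i, M i) := L.map fun s => ⟨s.1, s.2.1⟩

/-- The list of second components of a list of pairs of letters. -/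
def snds (L : List (Σ i, M i × M i)) : List (Σ i, M i) := L.map fun s => ⟨s.1, s.2.2⟩

/-- The total distance between the two components of a list of pairs of letters. -/
def cost (d : ∀ i, M i → M i → ℝ) (L : List (Σ i, M i × M i)) : ℝ :=
  (L.map fun s => d s.1 s.2.1 s.2.2).sum

@[simp] lemma fsts_nil : fsts ([] : List (Σ i, M i × M i)) = [] := rfl

@[simp] lemma fsts_cons (s : Σ i, M i × M i) (L) : fsts (s :: L) = ⟨s.1, s.2.1⟩ :: fsts L := rfl

@[simp] lemma fsts_append (L L' : List (Σ i, M i × M i)) :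
    fsts (L ++ L') = fsts L ++ fsts L' := by simp [fsts]

@[simp] lemma snds_nil : snds ([] : List (Σ i, M i × M i)) = [] := rfl

@[simp] lemma snds_cons (s : Σ i, M i × M i) (L) : snds (s :: L) = ⟨s.1, s.2.2⟩ :: snds L := rfl

@[simp] lemma snds_append (L L' : List (Σ i, M i × M i)) :
    snds (L ++ L') = snds L ++ snds L' := by simp [snds]

variable {d : ∀ i, M i → M i → ℝ}

@[simp] lemma cost_nil : cost d [] = 0 := rfl

@[simp] lemma cost_cons (s : Σ i, M i × M i) (L) :
    cost d (s :: L) = d s.1 s.2.1 s.2.2 + cost d L := by simp [cost]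

@[simp] lemma cost_append (L L' : List (Σ i, M i × M i)) :
    cost d (L ++ L') = cost d L + cost d L' := by simp [cost]

lemma exists_of_snds_eq_append {L : List (Σ i, M i × M i)} {v w : List (Σ i, M i)} {i : ι}
    {c : M i} (h : snds L = v ++ ⟨i, c⟩ :: w) :
    ∃ V a W, L = V ++ ⟨i, (a, c)⟩ :: W ∧ snds V = v := by
  simp only [snds, List.map_eq_append_iff, List.map_eq_cons_iff] at h
  obtain ⟨V, T, rfl, rfl, ⟨j, a, c'⟩, W, rfl, e, rfl⟩ := h
  obtain ⟨rfl, e⟩ := Sigma.mk.inj_iff.1 e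
  obtain rfl := eq_of_heq e
  exact ⟨V, a, W, rfl, rfl⟩

end Pairs

end FreeProdClosed

namespace IsTSIMetric

variable {G : Type*} [Group G] {d : G → G → ℝ}

lemma self (hd : IsTSIMetric d) (x : G) : d x x = 0 := (hd.1 x x).2 rfl

lemma nonneg (hd : IsTSIMetric d) (x y : G) : 0 ≤ d x y := by
  have := hd.2.2.1 x y x
  rw [hd.self, hd.2.1 y x] at this
  linarith

lemma mul_le (hd : IsTSIMetric d) (a b a' b' : G) : d (a * b) (a' * b') ≤ d a a' + d b b' := by
  have := hd.2.2.1 (a * b) (a' * b) (a' * b')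
  rwa [hd.2.2.2.2, hd.2.2.2.1] at this

end IsTSIMetric

namespace FreeProdClosed

open Monoid

variable {ι : Type*} {M : ι → Type*} [∀ i, Group (M i)]

/-- An approximation of an element by elements of the subgroup generated by the `A i` can be made
letter by letter along a reduced word, at no extra cost. -/
theorem exists_pairs_isReduced {d : ∀ i, M i → M i → ℝ} (hd : ∀ i, IsTSIMetric (d i))
    {A : ∀ i, Subgroup (M i)} (L : List (Σ i, M i × M i))
    (hL : letterProd (snds L) ∈ ⨆ i, (A i).map (CoprodI.of : M i →* CoprodI M)) :
    ∃ L', IsReduced (fsts L') ∧ letterProd (fsts L') = letterProd (fsts L) ∧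
      letterProd (snds L') ∈ (⨆ i, (A i).map (CoprodI.of : M i →* CoprodI M)) ∧
      cost d L' ≤ cost d L := by
  induction hn : L.length using Nat.strong_induction_on generalizing L with
  | _ n ih =>
    rcases isReduced_or (fsts L) with h | ⟨l₁, i, l₂, h⟩ | ⟨l₁, i, a, b, l₂, h⟩
    · exact ⟨L, h, rfl, hL, le_rfl⟩
    · simp only [fsts, List.map_eq_append_iff, List.map_eq_cons_iff] at h
      obtain ⟨L₁, T, rfl, -, ⟨j, a, b⟩, L₂, rfl, e, -⟩ := h
      obtain ⟨rfl, e⟩ := Sigma.mk.inj_iff.1 e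
      obtain rfl : a = 1 := eq_of_heq e
      rcases mem_iSup_or_hasPartner (A := A) (invRev (snds L₁)) (snds L₂) b
        (by simpa [letterProd_invRev, mul_assoc] using hL) with h | h | h
      · obtain ⟨L', h₁, h₂, h₃, h₄⟩ := ih _ (by simp at hn ⊢; omega) (L₁ ++ L₂)
          (by simpa [letterProd_invRev] using h) rfl
        refine ⟨L', h₁, by simp [h₂], h₃, h₄.trans ?_⟩
        have := (hd j).nonneg 1 b
        simp only [cost_append, cost_cons]
        linarith
      · obtain ⟨v, c, w, hv, hv1⟩ := h.exists_eq_append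
        have hv' : snds L₁ = invRev w ++ ⟨j, c⁻¹⟩ :: invRev v := by
          have := congrArg invRev hv
          simpa [invRev, Function.comp_def] using this
        obtain ⟨V, a, W, rfl, hV⟩ := exists_of_snds_eq_append hv'
        have hW : letterProd (snds W) = 1 := by
          have : snds W = invRev v := by simpa [hV] using hv'
          simpa [this, letterProd_invRev] using hv1
        obtain ⟨L', h₁, h₂, h₃, h₄⟩ := ih _ (by simp at hn ⊢; omega)
          (V ++ ⟨j, (a, c⁻¹ * b)⟩ :: (W ++ L₂)) (by simpa [hW, mul_assoc] using hL) rfl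
        refine ⟨L', h₁, by simp [h₂], h₃, h₄.trans ?_⟩
        have := (hd j).mul_le a 1 c⁻¹ b
        simp only [mul_one] at this
        simp only [cost_append, cost_cons]
        linarith
      · obtain ⟨v, c, w, hv, hv1⟩ := h.exists_eq_append
        obtain ⟨V, a, W, rfl, hV⟩ := exists_of_snds_eq_append hv
        rw [← hV, one_mul] at hv1
        obtain ⟨L', h₁, h₂, h₃, h₄⟩ := ih _ (by simp at hn ⊢; omega)
          (L₁ ++ (V ++ ⟨j, (a, b * c)⟩ :: W)) (by simpa [hv1, mul_assoc] using hL) rfl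
        refine ⟨L', h₁, by simp [h₂], h₃, h₄.trans ?_⟩
        have := (hd j).mul_le 1 a b c
        simp only [one_mul] at this
        simp only [cost_append, cost_cons]
        linarith
    · simp only [fsts, List.map_eq_append_iff, List.map_eq_cons_iff] at h
      obtain ⟨L₁, T, rfl, -, ⟨j, x, x'⟩, T, rfl, e, ⟨k, y, y'⟩, L₂, rfl, e', -⟩ := h
      obtain rfl : j = i := congrArg Sigma.fst e
      obtain rfl : k = j := congrArg Sigma.fst e'
      clear e e'
      obtain ⟨L', h₁, h₂, h₃, h₄⟩ := ih _ (by simp at hn ⊢; omega)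
        (L₁ ++ ⟨k, (x * y, x' * y')⟩ :: L₂) (by simpa [mul_assoc] using hL) rfl
      refine ⟨L', h₁, by simp [h₂, mul_assoc], h₃, h₄.trans ?_⟩
      have := (hd k).mul_le x y x' y'
      simp only [cost_append, cost_cons]
      linarith

/-- The subgroup of a free product generated by closed subgroups of the factors is closed. -/
theorem mem_iSup_of_forall_cost {d : ∀ i, M i → M i → ℝ} (hd : ∀ i, IsTSIMetric (d i))
    {A : ∀ i, Subgroup (M i)} (hA : ∀ i, IsDClosed (d i) (A i : Set (M i))) (x : CoprodI M)
    (hx : ∀ ε : ℝ, 0 < ε → ∃ L : List (Σ i, M i × M i), letterProd (fsts L) = x ∧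
      letterProd (snds L) ∈ (⨆ i, (A i).map (CoprodI.of : M i →* CoprodI M)) ∧ cost d L < ε) :
    x ∈ ⨆ i, (A i).map (CoprodI.of : M i →* CoprodI M) := by
  obtain ⟨L₀, h₀, -⟩ := hx 1 one_pos
  obtain ⟨w, hw, ew, -⟩ := exists_isReduced (fsts L₀)
  have key : ∀ s : Σ i, M i, s.2 ≠ 1 → ∃ δ : ℝ, 0 < δ ∧
      ∀ b, d s.1 s.2 b < δ → b ≠ 1 ∧ (b ∈ A s.1 → s.2 ∈ A s.1) := by
    rintro ⟨i, a⟩ ha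
    have h1 : 0 < d i a 1 :=
      lt_of_le_of_ne ((hd i).nonneg a 1) fun h => ha (((hd i).1 a 1).1 h.symm)
    by_cases hmem : a ∈ A i
    · exact ⟨d i a 1, h1, fun b hb => ⟨fun e => (e ▸ hb).false, fun _ => hmem⟩⟩
    · have := mt (hA i a) hmem
      push Not at this
      obtain ⟨δ, hδ, h⟩ := this
      exact ⟨min (d i a 1) δ, lt_min h1 hδ, fun b hb => ⟨fun e => by
        have := hb.trans_le (min_le_left _ _)
        exact (e ▸ this).false, fun hbA =>
        absurd (hb.trans_le (min_le_right _ _)) (not_lt.2 (h b hbA))⟩⟩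
  have hε : ∃ ε : ℝ, 0 < ε ∧ ∀ s ∈ w, ∀ b, d s.1 s.2 b < ε →
      b ≠ 1 ∧ (b ∈ A s.1 → s.2 ∈ A s.1) := by
    have hw1 := hw.1
    clear hw ew
    induction w with
    | nil => exact ⟨1, one_pos, by simp⟩
    | cons s w ih =>
      obtain ⟨ε, hε, h⟩ := ih fun t ht => hw1 t (by simp [ht])
      obtain ⟨δ, hδ, h'⟩ := key s (hw1 s (by simp))
      refine ⟨min δ ε, lt_min hδ hε, fun t ht b hb => ?_⟩
      rcases List.mem_cons.1 ht with rfl | ht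
      · exact h' b (hb.trans_le (min_le_left _ _))
      · exact h t ht b (hb.trans_le (min_le_right _ _))
  obtain ⟨ε, hε, hwε⟩ := hε
  obtain ⟨L₁, h₁, h₁', h₁''⟩ := hx ε hε
  obtain ⟨L, hr, hp, hm, hc⟩ := exists_pairs_isReduced hd L₁ h₁'
  have hLw : fsts L = w := hr.eq_of_letterProd_eq hw (by rw [hp, h₁, ew, h₀])
  have hlt : ∀ s ∈ L, d s.1 s.2.1 s.2.2 < ε := fun s hs =>
    (List.single_le_sum (List.forall_mem_map.2 fun _ _ => (hd _).nonneg _ _) _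
      (List.mem_map_of_mem (f := fun s => d s.1 s.2.1 s.2.2) hs)).trans_lt (hc.trans_lt h₁'')
  have hfst : ∀ s ∈ L, (⟨s.1, s.2.1⟩ : Σ i, M i) ∈ w := fun s hs =>
    hLw ▸ List.mem_map_of_mem (f := fun s : Σ i, M i × M i => (⟨s.1, s.2.1⟩ : Σ i, M i)) hs
  have hsnd : IsReduced (snds L) := by
    refine ⟨fun s hs => ?_, ?_⟩
    · obtain ⟨t, ht, rfl⟩ := List.mem_map.1 hs
      exact (hwε _ (hfst t ht) _ (hlt t ht)).1
    · have := hr.2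
      rw [fsts, List.isChain_map] at this
      rwa [snds, List.isChain_map]
  have hA' := hsnd.forall_mem hm
  rw [← h₁, ← hp]
  refine letterProd_mem_iSup fun s hs => ?_
  obtain ⟨t, ht, rfl⟩ := List.mem_map.1 hs
  exact (hwε _ (hfst t ht) _ (hlt t ht)).2
    (hA' _ (List.mem_map_of_mem (f := fun s : Σ i, M i × M i => (⟨s.1, s.2.2⟩ : Σ i, M i)) ht))

section Graev

variable {G : Type*} [Group G]

/-- `Near d x y r` means that `x` and `y` factor into elements of `G` and powers of `t`, paired
factor by factor at total distance `r`. -/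
inductive Near (d : G → G → ℝ) :
    Coprod G (Multiplicative ℤ) → Coprod G (Multiplicative ℤ) → ℝ → Prop
  | inl (g h : G) : Near d (Coprod.inl g) (Coprod.inl h) (d g h)
  | inr (m n : ℤ) : Near d (Coprod.inr (Multiplicative.ofAdd m))
      (Coprod.inr (Multiplicative.ofAdd n)) |(m : ℝ) - (n : ℝ)|
  | mul {x y x' y' : Coprod G (Multiplicative ℤ)} {r r' : ℝ} :
      Near d x y r → Near d x' y' r' → Near d (x * x') (y * y') (r + r')

variable {d : G → G → ℝ}

lemma Near.nonneg (hd : IsTSIMetric d) {x y : Coprod G (Multiplicative ℤ)} {r : ℝ}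
    (h : Near d x y r) : 0 ≤ r := by
  induction h with
  | inl g h => exact hd.nonneg g h
  | inr m n => exact abs_nonneg _
  | mul _ _ h₁ h₂ => exact add_nonneg h₁ h₂

lemma Near.symm (hd : IsTSIMetric d) {x y : Coprod G (Multiplicative ℤ)} {r : ℝ}
    (h : Near d x y r) : Near d y x r := by
  induction h with
  | inl g h => rw [hd.2.1]; exact .inl h g
  | inr m n => rw [abs_sub_comm]; exact .inr n m
  | mul _ _ h₁ h₂ => exact h₁.mul h₂

lemma Near.refl (hd : IsTSIMetric d) (x : Coprod G (Multiplicative ℤ)) : Near d x x 0 := by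
  induction x using Coprod.induction_on with
  | inl g => simpa [hd.self] using Near.inl (d := d) g g
  | inr n => simpa using Near.inr (d := d) n.toAdd n.toAdd
  | mul x y hx hy => simpa using hx.mul hy

lemma Near.trans (hd : IsTSIMetric d) {x y z : Coprod G (Multiplicative ℤ)} {r s : ℝ}
    (h₁ : Near d x y r) (h₂ : Near d y z s) : Near d x z (r + s) := by
  simpa using (h₁.mul (Near.refl hd y⁻¹)).mul h₂

lemma exists_near (hd : IsTSIMetric d) (x y : Coprod G (Multiplicative ℤ)) :
    ∃ r, Near d x y r := by
  have key : ∀ x, ∃ r, Near d x 1 r := by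
    intro x
    induction x using Coprod.induction_on with
    | inl g => exact ⟨d g 1, by simpa using Near.inl (d := d) g 1⟩
    | inr n => exact ⟨_, by simpa using Near.inr (d := d) n.toAdd 0⟩
    | mul x y hx hy =>
      obtain ⟨r, hr⟩ := hx
      obtain ⟨s, hs⟩ := hy
      exact ⟨r + s, by simpa using hr.mul hs⟩
  obtain ⟨r, hr⟩ := key x
  obtain ⟨s, hs⟩ := key y
  exact ⟨r + s, hr.trans hd (hs.symm hd)⟩

/-- The infimum of the total distances of factorizations of two elements. -/
noncomputable def nearDist (d : G → G → ℝ) (x y : Coprod G (Multiplicative ℤ)) : ℝ :=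
  sInf {r | Near d x y r}

lemma nearDist_le (hd : IsTSIMetric d) {x y : Coprod G (Multiplicative ℤ)} {r : ℝ}
    (h : Near d x y r) : nearDist d x y ≤ r :=
  csInf_le ⟨0, fun _ hs => Near.nonneg hd hs⟩ h

lemma le_nearDist (hd : IsTSIMetric d) {x y : Coprod G (Multiplicative ℤ)} {c : ℝ}
    (h : ∀ r, Near d x y r → c ≤ r) : c ≤ nearDist d x y :=
  le_csInf (exists_near hd x y) h

lemma nearDist_mul_left_le (hd : IsTSIMetric d) (g x y : Coprod G (Multiplicative ℤ)) :
    nearDist d (g * x) (g * y) ≤ nearDist d x y :=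
  le_nearDist hd fun _ h => nearDist_le hd (by simpa using (Near.refl hd g).mul h)

lemma nearDist_mul_right_le (hd : IsTSIMetric d) (g x y : Coprod G (Multiplicative ℤ)) :
    nearDist d (x * g) (y * g) ≤ nearDist d x y :=
  le_nearDist hd fun _ h => nearDist_le hd (by simpa using h.mul (Near.refl hd g))

lemma nearDist_mul_left (hd : IsTSIMetric d) (g x y : Coprod G (Multiplicative ℤ)) :
    nearDist d (g * x) (g * y) = nearDist d x y :=
  (nearDist_mul_left_le hd g x y).antisymm
    (by simpa using nearDist_mul_left_le hd g⁻¹ (g * x) (g * y))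

lemma nearDist_mul_right (hd : IsTSIMetric d) (g x y : Coprod G (Multiplicative ℤ)) :
    nearDist d (x * g) (y * g) = nearDist d x y :=
  (nearDist_mul_right_le hd g x y).antisymm
    (by simpa using nearDist_mul_right_le hd g⁻¹ (x * g) (y * g))

lemma nearDist_self (hd : IsTSIMetric d) (x : Coprod G (Multiplicative ℤ)) :
    nearDist d x x = 0 :=
  (nearDist_le hd (Near.refl hd x)).antisymm (le_nearDist hd fun _ h => h.nonneg hd)

lemma nearDist_comm (hd : IsTSIMetric d) (x y : Coprod G (Multiplicative ℤ)) :
    nearDist d x y = nearDist d y x :=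
  (le_nearDist hd fun _ h => nearDist_le hd (h.symm hd)).antisymm
    (le_nearDist hd fun _ h => nearDist_le hd (h.symm hd))

lemma nearDist_triangle (hd : IsTSIMetric d) (x y z : Coprod G (Multiplicative ℤ)) :
    nearDist d x z ≤ nearDist d x y + nearDist d y z := by
  rw [← sub_le_iff_le_add]
  refine le_nearDist hd fun r hr => ?_
  rw [sub_le_iff_le_add, ← sub_le_iff_le_add']
  refine le_nearDist hd fun s hs => ?_
  rw [sub_le_iff_le_add']
  exact nearDist_le hd (hr.trans hd hs)

/-- By maximality, the Graev metric dominates `nearDist`. -/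
lemma nearDist_le_of_isGraevMetric (hd : IsTSIMetric d)
    {ds : Coprod G (Multiplicative ℤ) → Coprod G (Multiplicative ℤ) → ℝ}
    (hds : IsGraevMetricFreeProdZ d ds) (x y : Coprod G (Multiplicative ℤ)) :
    nearDist d x y ≤ ds x y := by
  obtain ⟨hs, hG, hZ, hGZ, hmax⟩ := hds
  refine (le_max_right _ _).trans
    (hmax (fun x y => max (ds x y) (nearDist d x y)) ⟨?_, ?_, ?_, ?_, ?_⟩ ?_ ?_ ?_ x y)
  · refine fun x y => ⟨fun h => (hs.1 x y).1 ?_, ?_⟩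
    · exact ((le_max_left _ _).trans_eq h).antisymm (hs.nonneg x y)
    · rintro rfl
      simp [hs.self, nearDist_self hd]
  · intro x y
    simp only [hs.2.1 x y, nearDist_comm hd x y]
  · intro x y z
    exact max_le ((hs.2.2.1 x y z).trans (add_le_add (le_max_left _ _) (le_max_left _ _)))
      ((nearDist_triangle hd x y z).trans (add_le_add (le_max_right _ _) (le_max_right _ _)))
  · intro g x y
    simp only [hs.2.2.2.1, nearDist_mul_left hd]
  · intro g x y
    simp only [hs.2.2.2.2, nearDist_mul_right hd]
  · intro g h
    rw [hG]
    exact max_eq_left (nearDist_le hd (.inl g h))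
  · intro m n
    rw [hZ]
    exact max_eq_left (nearDist_le hd (.inr m n))
  · intro g k
    rw [hGZ]
    refine max_eq_left (nearDist_le hd ?_)
    simpa using (Near.inl (d := d) g 1).mul (Near.inr (d := d) 0 k)

/-- The embedding of the free product of the groups `tⁿGt⁻ⁿ` into `G ∗ ⟨t⟩`. -/
def conjHom (G : Type*) [Group G] :
    CoprodI (fun _ : ℤ => G) →* Coprod G (Multiplicative ℤ) :=
  CoprodI.lift fun n =>
    (MulAut.conj (Coprod.inr (Multiplicative.ofAdd n))).toMonoidHom.comp Coprod.inl

lemma conjHom_of (n : ℤ) (g : G) : conjHom G (CoprodI.of (i := n) g) =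
    Coprod.inr (Multiplicative.ofAdd n) * Coprod.inl g *
      (Coprod.inr (Multiplicative.ofAdd n))⁻¹ := by
  simp [conjHom]

/-- The action of `G ∗ ⟨t⟩` on itself by left multiplication, where `(n, x)` stands for `tⁿx`. -/
def act (G : Type*) [Group G] : Coprod G (Multiplicative ℤ) →*
    Function.End (ℤ × CoprodI (fun _ : ℤ => G)) :=
  Coprod.lift
    { toFun := fun g p => (p.1, CoprodI.of (i := -p.1) g * p.2)
      map_one' := funext fun p => by simp; rfl
      map_mul' := fun g h => funext fun p => by simp [mul_assoc]; rfl }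
    { toFun := fun m p => (m.toAdd + p.1, p.2)
      map_one' := funext fun p => by simp; rfl
      map_mul' := fun m n => funext fun p => by simp [add_assoc]; rfl }

lemma act_inl (g : G) (p : ℤ × CoprodI (fun _ : ℤ => G)) :
    act G (Coprod.inl g) p = (p.1, CoprodI.of (i := -p.1) g * p.2) := rfl

lemma act_inr (m : ℤ) (p : ℤ × CoprodI (fun _ : ℤ => G)) :
    act G (Coprod.inr (Multiplicative.ofAdd m)) p = (m + p.1, p.2) := rfl

lemma act_mul (a b : Coprod G (Multiplicative ℤ)) (p : ℤ × CoprodI (fun _ : ℤ => G)) :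
    act G (a * b) p = act G a (act G b p) := by
  rw [map_mul]
  rfl

lemma act_conjHom (x y : CoprodI (fun _ : ℤ => G)) :
    act G (conjHom G x) (0, y) = (0, x * y) := by
  induction x using CoprodI.induction_on generalizing y with
  | one =>
    rw [map_one, map_one, one_mul]
    rfl
  | of n g =>
    rw [conjHom_of, ← map_inv, ← ofAdd_neg, act_mul, act_mul, act_inr, act_inl, act_inr]
    simp
  | mul a b ha hb => rw [map_mul, act_mul, hb, ha, mul_assoc]

lemma conjHom_mul_inr_inj {x y : CoprodI (fun _ : ℤ => G)} {m : ℤ}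
    (h : conjHom G x * Coprod.inr (Multiplicative.ofAdd m) = conjHom G y) : m = 0 ∧ x = y := by
  have e : conjHom G (y⁻¹ * x) = Coprod.inr (Multiplicative.ofAdd (-m)) := by
    rw [map_mul, map_inv, ← h]
    simp
  have := congrArg (fun z => act G z (0, 1)) e
  simp only [act_conjHom, act_inr, Prod.mk.injEq, mul_one] at this
  exact ⟨by omega, (inv_mul_eq_one.1 this.2).symm⟩

/-- Elements at distance less than `1` have the same `t`-exponent and are compared letter by letter
in the free product of the conjugates of `G`. -/
lemma Near.exists_pairs (hd : IsTSIMetric d) {x y : Coprod G (Multiplicative ℤ)} {r : ℝ}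
    (h : Near d x y r) (hr : r < 1) (a : ℤ) :
    ∃ (L : List (Σ _ : ℤ, G × G)) (b : ℤ), cost (fun _ => d) L ≤ r ∧
      Coprod.inr (Multiplicative.ofAdd a) * x =
        conjHom G (letterProd (fsts L)) * Coprod.inr (Multiplicative.ofAdd b) ∧
      Coprod.inr (Multiplicative.ofAdd a) * y =
        conjHom G (letterProd (snds L)) * Coprod.inr (Multiplicative.ofAdd b) := by
  induction h generalizing a with
  | inl g h => exact ⟨[⟨a, (g, h)⟩], a, by simp, by simp [conjHom_of], by simp [conjHom_of]⟩
  | inr m n =>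
    obtain rfl : m = n := by
      have : |m - n| < 1 := by exact_mod_cast hr
      exact sub_eq_zero.1 (Int.abs_lt_one_iff.1 this)
    exact ⟨[], a + m, by simp, by simp, by simp⟩
  | mul h₁ h₂ ih₁ ih₂ =>
    have := h₁.nonneg hd
    have := h₂.nonneg hd
    obtain ⟨L, b, hc, hx, hy⟩ := ih₁ (by linarith) a
    obtain ⟨L', c, hc', hx', hy'⟩ := ih₂ (by linarith) b
    refine ⟨L ++ L', c, by simpa using add_le_add hc hc', ?_, ?_⟩
    · rw [← mul_assoc, hx, mul_assoc, hx', ← mul_assoc]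
      simp
    · rw [← mul_assoc, hy, mul_assoc, hy', ← mul_assoc]
      simp

/-- The subgroups `G`, `A` and `1` of the factors with index `0`, `1` and any other index. -/
def factorSubgroup (A : Subgroup G) (n : ℤ) : Subgroup G :=
  if n = 0 then ⊤ else if n = 1 then A else ⊥

lemma isDClosed_factorSubgroup (hd : IsTSIMetric d) {A : Subgroup G}
    (hA : IsDClosed d (A : Set G)) (n : ℤ) : IsDClosed d (factorSubgroup A n : Set G) := by
  unfold factorSubgroup
  split_ifs
  · exact fun _ _ => trivial
  · exact hA
  · intro x hx
    simp only [Subgroup.coe_bot, Set.mem_singleton_iff, exists_eq_left] at hx ⊢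
    exact (hd.1 x 1).1 (le_antisymm (le_of_forall_pos_lt_add fun ε hε => by simpa using hx ε hε)
      (hd.nonneg x 1))

lemma map_iSup_factorSubgroup (A : Subgroup G) :
    (⨆ n : ℤ, (factorSubgroup A n).map
      (CoprodI.of (M := fun _ : ℤ => G) (i := n))).map (conjHom G) =
    Subgroup.closure
        (Set.range (⇑(Coprod.inl : G →* Coprod G (Multiplicative ℤ))) ∪
          Set.range (fun a : A =>
            Coprod.inr (Multiplicative.ofAdd (1 : ℤ)) * Coprod.inl (↑a : G) *
              (Coprod.inr (Multiplicative.ofAdd (1 : ℤ)))⁻¹)) := by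
  apply le_antisymm
  · rw [Subgroup.map_iSup, iSup_le_iff]
    rintro n _ ⟨_, ⟨g, hg, rfl⟩, rfl⟩
    rw [conjHom_of]
    unfold factorSubgroup at hg
    split_ifs at hg with h0 h1
    · subst h0
      exact Subgroup.subset_closure (Or.inl ⟨g, by simp⟩)
    · subst h1
      exact Subgroup.subset_closure (Or.inr ⟨⟨g, hg⟩, rfl⟩)
    · obtain rfl : g = 1 := hg
      simp
  · rw [Subgroup.closure_le]
    rintro _ (⟨g, rfl⟩ | ⟨a, rfl⟩)
    · refine ⟨CoprodI.of (i := 0) g, Subgroup.mem_iSup_of_mem 0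
        (Subgroup.mem_map_of_mem _ ?_), by simp [conjHom_of]⟩
      simp [factorSubgroup]
    · refine ⟨CoprodI.of (i := 1) (a : G), Subgroup.mem_iSup_of_mem 1
        (Subgroup.mem_map_of_mem _ ?_), by simp [conjHom_of]⟩
      simp [factorSubgroup]

end Graev

end FreeProdClosed

/-- **`G ∗ tAt⁻¹` is closed in `G ∗ ⟨t⟩`.**  If `A` is a closed subgroup of a tsi group
`(G, d)`, then the subgroup of the free product `G ∗ ⟨t⟩` generated by `G` together with
`{ t a t⁻¹ : a ∈ A }` is closed with respect to the Graev metric. -/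
theorem free_prod_conj_closed {G : Type*} [Group G]
    (d : G → G → ℝ) (hd : IsTSIMetric d) (A : Subgroup G) (hA : IsDClosed d (A : Set G))
    (ds : Monoid.Coprod G (Multiplicative ℤ) → Monoid.Coprod G (Multiplicative ℤ) → ℝ)
    (hds : IsGraevMetricFreeProdZ d ds) :
    IsDClosed ds
      ((Subgroup.closure
        (Set.range (⇑(Monoid.Coprod.inl : G →* Monoid.Coprod G (Multiplicative ℤ))) ∪
          Set.range (fun a : A =>
            Monoid.Coprod.inr (Multiplicative.ofAdd (1 : ℤ)) * Monoid.Coprod.inl (↑a : G) *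
              (Monoid.Coprod.inr (Multiplicative.ofAdd (1 : ℤ)))⁻¹))) :
        Set (Monoid.Coprod G (Multiplicative ℤ))) := by
  intro f hf
  rw [← FreeProdClosed.map_iSup_factorSubgroup] at hf ⊢
  have approx : ∀ ε : ℝ, 0 < ε → ∃ L : List (Σ _ : ℤ, G × G),
      Monoid.Coprod.inr (Multiplicative.ofAdd (0 : ℤ)) * f =
        FreeProdClosed.conjHom G (FreeProdClosed.letterProd (FreeProdClosed.fsts L)) ∧
      FreeProdClosed.letterProd (FreeProdClosed.snds L) ∈
        (⨆ n : ℤ, (FreeProdClosed.factorSubgroup A n).map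
          (Monoid.CoprodI.of (M := fun _ : ℤ => G) (i := n))) ∧
      FreeProdClosed.cost (fun _ => d) L < ε := by
    intro ε hε
    obtain ⟨_, ⟨k, hk, rfl⟩, hlt⟩ := hf (min ε 1) (lt_min hε one_pos)
    obtain ⟨r, hr, hrε⟩ := exists_lt_of_csInf_lt (FreeProdClosed.exists_near hd f _)
      ((FreeProdClosed.nearDist_le_of_isGraevMetric hd hds f _).trans_lt hlt)
    obtain ⟨L, b, hc, hx, hy⟩ := FreeProdClosed.Near.exists_pairs hd hr
      (hrε.trans_le (min_le_right _ _)) 0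
    obtain ⟨rfl, e⟩ := FreeProdClosed.conjHom_mul_inr_inj (y := k) (hy.symm.trans (by simp))
    exact ⟨L, by simpa using hx, e ▸ hk, hc.trans_lt (hrε.trans_le (min_le_left _ _))⟩
  obtain ⟨L₀, h₀, -⟩ := approx 1 one_pos
  refine ⟨FreeProdClosed.letterProd (FreeProdClosed.fsts L₀),
    FreeProdClosed.mem_iSup_of_forall_cost (d := fun _ => d) (fun _ => hd)
      (FreeProdClosed.isDClosed_factorSubgroup hd hA) _ fun ε hε => ?_, by simp [← h₀]⟩
  obtain ⟨L, h, hm, hc⟩ := approx ε hε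
  exact ⟨L, (FreeProdClosed.conjHom_mul_inr_inj (m := 0)
    (by simpa using h.symm.trans h₀)).2, hm, hc⟩
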